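/- Optimality of myopic sensing for the finite-horizon discounted problem with positively correlated channels: assume p11 ≥ p01, 0 ≤ β ≤ 1, and β·ℛ̄ ≤ ℛ̲. Then for every t ∈ {1,…,T} and every belief vector ω ∈ [0,1]^N with p11 ≥ ω₁ ≥ ω₂ ≥ … ≥ ω_N ≥ p01, the myopic policy achieves the optimal value: W_t(ω) = V_t(ω). -/

import Mathlib

open Finset

noncomputable section

/-- Belief update map `τ(ω) = ω·p11 + (1-ω)·p01`. -/
def tau (p01 p11 ω : ℝ) : ℝ := ω * p11 + (1 - ω) * p01

/-- Expected one-step reward `R_m(ω; S)` with access cap `m`: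
the expectation of `min(#available, m)` when each channel `i ∈ S` is
independently available with probability `ω i`. -/
def expReward {ι : Type*} [DecidableEq ι] (m : ℕ) (S : Finset ι) (ω : ι → ℝ) : ℝ :=
  ∑ A ∈ S.powerset,
    (∏ i ∈ A, ω i) * (∏ i ∈ S \ A, (1 - ω i)) * ((min A.card m : ℕ) : ℝ)

/-- The set of reward increments `R_m(1,x) − R_m(0,x)` over `x ∈ [lo,hi]^{k'}`
(on `k' + 1` channels). -/
def RdiffSet (lo hi : ℝ) (m k' : ℕ) : Set ℝ :=
  { r : ℝ | ∃ x : Fin k' → ℝ, (∀ i, x i ∈ Set.Icc lo hi) ∧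
      r = expReward m Finset.univ (Fin.cons 1 x) -
          expReward m Finset.univ (Fin.cons 0 x) }

/-- `ℛ̄`: maximal reward increment. -/
def Rbar (lo hi : ℝ) (m k' : ℕ) : ℝ := sSup (RdiffSet lo hi m k')

/-- `ℛ̲`: minimal reward increment. -/
def Rlow (lo hi : ℝ) (m k' : ℕ) : ℝ := sInf (RdiffSet lo hi m k')

/-- The first `k` channels out of `N` (the myopically sensed channels for a
descending-ordered belief vector). -/
def senseSet (N k : ℕ) : Finset (Fin N) := Finset.univ.filter (fun i => (i : ℕ) < k)

/-- Positively correlated case successor belief vector: `c` copies of `p11`,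
then `τ(ω_{k+1}), …, τ(ω_N)`, then `k - c` copies of `p01`. -/
def nextPos (p01 p11 : ℝ) {N : ℕ} (k : ℕ) (ω : Fin N → ℝ) (c : ℕ) : Fin N → ℝ :=
  fun i =>
    if h1 : (i : ℕ) < c then p11
    else if h2 : (i : ℕ) < c + (N - k) then
      tau p01 p11 (ω ⟨k + ((i : ℕ) - c), by have := i.isLt; omega⟩)
    else p01

/-- Negatively correlated case successor belief vector: `k - c` copies of `p01`,
then `τ(ω_N), τ(ω_{N-1}), …, τ(ω_{k+1})` (reversed), then `c` copies of `p11`. -/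
def nextNeg (p01 p11 : ℝ) {N : ℕ} (k : ℕ) (ω : Fin N → ℝ) (c : ℕ) : Fin N → ℝ :=
  fun i =>
    if h1 : (i : ℕ) < k - c then p01
    else if h2 : (i : ℕ) < (k - c) + (N - k) then
      tau p01 p11 (ω ⟨N - 1 - ((i : ℕ) - (k - c)), by have := i.isLt; omega⟩)
    else p11

/-- Myopic value functions for the positively correlated case, indexed by the
number `s` of remaining steps (so `W_t = Wpos (T - t)`). -/
def Wpos (p01 p11 β : ℝ) (N k m : ℕ) : ℕ → (Fin N → ℝ) → ℝ
  | 0, ω => expReward m (senseSet N k) ω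
  | s + 1, ω =>
    expReward m (senseSet N k) ω +
      β * ∑ A ∈ (senseSet N k).powerset,
        (∏ i ∈ A, ω i) * (∏ i ∈ senseSet N k \ A, (1 - ω i)) *
          Wpos p01 p11 β N k m s (nextPos p01 p11 k ω A.card)

/-- Myopic value functions for the negatively correlated case, indexed by the
number `s` of remaining steps (so `W_t = Wneg (T - t)`). -/
def Wneg (p01 p11 β : ℝ) (N k m : ℕ) : ℕ → (Fin N → ℝ) → ℝ
  | 0, ω => expReward m (senseSet N k) ω
  | s + 1, ω =>
    expReward m (senseSet N k) ω +
      β * ∑ A ∈ (senseSet N k).powerset,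
        (∏ i ∈ A, ω i) * (∏ i ∈ senseSet N k \ A, (1 - ω i)) *
          Wneg p01 p11 β N k m s (nextNeg p01 p11 k ω A.card)

/-- Optimal value functions, indexed by the number `s` of remaining steps
(so `V_t = Vopt (T - t)`). -/
def Vopt (p01 p11 β : ℝ) (N k m : ℕ) : ℕ → (Fin N → ℝ) → ℝ
  | 0, ω => sSup { r : ℝ | ∃ π : Finset (Fin N), π.card = k ∧ r = expReward m π ω }
  | s + 1, ω =>
    sSup { r : ℝ | ∃ π : Finset (Fin N), π.card = k ∧
      r = expReward m π ω +
        β * ∑ B ∈ π.powerset,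
          (∏ i ∈ B, ω i) * (∏ i ∈ π \ B, (1 - ω i)) *
            Vopt p01 p11 β N k m s
              (fun j => if j ∈ B then p11 else if j ∈ π then p01 else tau p01 p11 (ω j)) }

/-- The cyclic right shift `(ω_N, ω_1, …, ω_{N-1})`. -/
def cycR {N : ℕ} (ω : Fin N → ℝ) : Fin N → ℝ :=
  fun i =>
    if h : (i : ℕ) = 0 then ω ⟨N - 1, by have := i.isLt; omega⟩
    else ω ⟨(i : ℕ) - 1, by have := i.isLt; omega⟩

/-- The cyclic left shift `(ω_2, ω_3, …, ω_N, ω_1)`. -/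
def cycL {N : ℕ} (ω : Fin N → ℝ) : Fin N → ℝ :=
  fun i =>
    if h : (i : ℕ) + 1 < N then ω ⟨(i : ℕ) + 1, h⟩
    else ω ⟨0, by have := i.isLt; omega⟩

/-- The vector `(ω_1, …, ω_{j-1}, x, y, ω_{j+2}, …, ω_N)` (0-indexed: `x` at
position `j`, `y` at position `j+1`). -/
def swapAt {N : ℕ} (ω : Fin N → ℝ) (j : ℕ) (x y : ℝ) : Fin N → ℝ :=
  fun i => if (i : ℕ) = j then x else if (i : ℕ) = j + 1 then y else ω i

end

/-- The expectation of `f` at the number of successes among independent trials whose success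
probabilities are listed in `u`. -/
def countExp : List ℝ → (ℕ → ℝ) → ℝ
  | [], f => f 0
  | x :: u, f => x * countExp u (fun a => f (a + 1)) + (1 - x) * countExp u f

theorem countExp_perm {u v : List ℝ} (h : u.Perm v) (f : ℕ → ℝ) :
    countExp u f = countExp v f := by
  induction h generalizing f with
  | nil => rfl
  | cons x _ ih => simp only [countExp, ih]
  | swap x y l => simp only [countExp]; ring
  | trans _ _ ih₁ ih₂ => rw [ih₁, ih₂]

theorem countExp_append_cons (a b : List ℝ) (x : ℝ) (f : ℕ → ℝ) :
    countExp (a ++ x :: b) f =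
      x * countExp (a ++ b) (fun c => f (c + 1)) + (1 - x) * countExp (a ++ b) f :=
  countExp_perm List.perm_middle f

theorem countExp_add (u : List ℝ) (f g : ℕ → ℝ) :
    countExp u (fun a => f a + g a) = countExp u f + countExp u g := by
  induction u generalizing f g with
  | nil => rfl
  | cons x u ih => simp only [countExp, ih]; ring

theorem countExp_const_mul (u : List ℝ) (c : ℝ) (f : ℕ → ℝ) :
    countExp u (fun a => c * f a) = c * countExp u f := by
  induction u generalizing f with
  | nil => rfl
  | cons x u ih => simp only [countExp, ih]; ring

theorem countExp_const (u : List ℝ) (c : ℝ) : countExp u (fun _ => c) = c := by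
  induction u with
  | nil => rfl
  | cons x u ih => simp only [countExp, ih]; ring

theorem countExp_sub (u : List ℝ) (f g : ℕ → ℝ) :
    countExp u (fun a => f a - g a) = countExp u f - countExp u g := by
  induction u generalizing f g with
  | nil => rfl
  | cons x u ih => simp only [countExp, ih]; ring

theorem countExp_mono {u : List ℝ} (hu : ∀ x ∈ u, x ∈ Set.Icc (0 : ℝ) 1) {f g : ℕ → ℝ}
    (h : ∀ a ≤ u.length, f a ≤ g a) : countExp u f ≤ countExp u g := by
  induction u generalizing f g with
  | nil => exact h 0 le_rfl
  | cons x u ih =>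
    have hx := hu x (by simp)
    have hu' : ∀ y ∈ u, y ∈ Set.Icc (0 : ℝ) 1 := fun y hy => hu y (by simp [hy])
    have h₁ := ih hu' (f := fun a => f (a + 1)) (g := fun a => g (a + 1))
      fun a ha => h (a + 1) (by simpa using ha)
    have h₀ := ih hu' (f := f) (g := g) fun a ha => h a (by simp; omega)
    simp only [countExp]
    have := mul_le_mul_of_nonneg_left h₁ hx.1
    have := mul_le_mul_of_nonneg_left h₀ (sub_nonneg.2 hx.2)
    linarith

theorem countExp_congr {u : List ℝ} {f g : ℕ → ℝ} (h : ∀ a ≤ u.length, f a = g a) :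
    countExp u f = countExp u g := by
  induction u generalizing f g with
  | nil => exact h 0 le_rfl
  | cons x u ih =>
    rw [countExp, countExp, ih (f := fun a => f (a + 1)) (g := fun a => g (a + 1))
      fun a ha => h (a + 1) (by simpa using ha), ih fun a ha => h a (by simp; omega)]

theorem sum_powerset_toFinset_eq_countExp {ι : Type*} [DecidableEq ι] {L : List ι}
    (hL : L.Nodup) (ω : ι → ℝ) (f : ℕ → ℝ) :
    ∑ A ∈ L.toFinset.powerset,
        (∏ i ∈ A, ω i) * (∏ i ∈ L.toFinset \ A, (1 - ω i)) * f A.card =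
      countExp (L.map ω) f := by
  induction L generalizing f with
  | nil => simp [countExp]
  | cons x L ih =>
    have hx : x ∉ L.toFinset := by simpa using (List.nodup_cons.1 hL).1
    have ih := ih (List.nodup_cons.1 hL).2
    rw [List.toFinset_cons, Finset.sum_powerset_insert hx, List.map_cons, countExp, ← ih, ← ih,
      Finset.mul_sum, Finset.mul_sum, add_comm]
    congr 1
    · refine Finset.sum_congr rfl fun A hA => ?_
      have hxA : x ∉ A := fun h => hx (Finset.mem_powerset.1 hA h)
      rw [Finset.prod_insert hxA, Finset.card_insert_of_notMem hxA, Finset.insert_sdiff_insert,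
        Finset.sdiff_insert_of_notMem hx]
      ring
    · refine Finset.sum_congr rfl fun A hA => ?_
      have hxA : x ∉ A := fun h => hx (Finset.mem_powerset.1 hA h)
      rw [Finset.insert_sdiff_of_notMem _ hxA, Finset.prod_insert (by simp [hx])]
      ring

theorem sum_powerset_eq_countExp {ι : Type*} [DecidableEq ι] (S : Finset ι)
    (ω : ι → ℝ) (f : ℕ → ℝ) :
    ∑ A ∈ S.powerset, (∏ i ∈ A, ω i) * (∏ i ∈ S \ A, (1 - ω i)) * f A.card =
      countExp (S.toList.map ω) f := by
  simpa using sum_powerset_toFinset_eq_countExp S.nodup_toList ω f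

theorem tau_mem_Icc {p01 p11 ω : ℝ} (hp : p01 ≤ p11) (hω : ω ∈ Set.Icc (0 : ℝ) 1) :
    tau p01 p11 ω ∈ Set.Icc p01 p11 := by
  obtain ⟨h₀, h₁⟩ := hω
  constructor <;> unfold tau <;> nlinarith

theorem tau_mono {p01 p11 : ℝ} (hp : p01 ≤ p11) : Monotone (tau p01 p11) := by
  intro x y hxy
  unfold tau
  nlinarith

/-- The list form of the successor belief vector after `c` successes among `k` sensed channels,
`t` being the beliefs of the channels that were not sensed. -/
def nextList (p01 p11 : ℝ) (k : ℕ) (t : List ℝ) (c : ℕ) : List ℝ :=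
  List.replicate c p11 ++ (t.map (tau p01 p11) ++ List.replicate (k - c) p01)

/-- The myopic value with `s` steps to go, for a list of beliefs whose first `k` entries are
sensed, where `c` successes yield the reward `r c`. -/
def listValue (p01 p11 β : ℝ) (k : ℕ) (r : ℕ → ℝ) : ℕ → List ℝ → ℝ
  | 0, _ => 0
  | s + 1, l => countExp (l.take k) fun c =>
      r c + β * listValue p01 p11 β k r s (nextList p01 p11 k (l.drop k) c)

section ListValue

variable {p01 p11 β : ℝ} {k : ℕ} {r : ℕ → ℝ}

theorem listValue_succ_append {u : List ℝ} (hu : u.length = k) (t : List ℝ) (s : ℕ) :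
    listValue p01 p11 β k r (s + 1) (u ++ t) = countExp u fun c =>
      r c + β * listValue p01 p11 β k r s (nextList p01 p11 k t c) := by
  simp [listValue, ← hu]

theorem listValue_affine (s : ℕ) (a b : List ℝ) (x y z : ℝ) :
    listValue p01 p11 β k r s (a ++ (x * y + (1 - x) * z) :: b) =
      x * listValue p01 p11 β k r s (a ++ y :: b) +
        (1 - x) * listValue p01 p11 β k r s (a ++ z :: b) := by
  induction s generalizing a b y z with
  | zero => simp [listValue]
  | succ s ih =>
    rcases lt_or_ge a.length k with h | h
    · obtain ⟨n, hn⟩ : ∃ n, k - a.length = n + 1 := ⟨k - a.length - 1, by omega⟩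
      simp only [listValue, List.take_append, List.drop_append, hn, List.take_succ_cons,
        List.drop_succ_cons, countExp_append_cons]
      ring
    · have hn : k - a.length = 0 := by omega
      have key : ∀ w c, nextList p01 p11 k (a.drop k ++ w :: b) c =
          (List.replicate c p11 ++ (a.drop k).map (tau p01 p11)) ++
            tau p01 p11 w :: (b.map (tau p01 p11) ++ List.replicate (k - c) p01) := by
        intro w c
        simp [nextList]
      have ht : tau p01 p11 (x * y + (1 - x) * z) =
          x * tau p01 p11 y + (1 - x) * tau p01 p11 z := by
        unfold tau; ring
      simp only [listValue, List.take_append, List.drop_append, hn, List.take_zero,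
        List.drop_zero, List.append_nil, key, ht, ih]
      rw [← countExp_const_mul, ← countExp_const_mul, ← countExp_add]
      congr 1
      funext c
      ring

/-- Moving a larger belief one place forward does not decrease the value. -/
def SwapMono (p01 p11 β : ℝ) (k : ℕ) (r : ℕ → ℝ) (s : ℕ) : Prop :=
  ∀ (a b : List ℝ) (x y : ℝ), (∀ w ∈ a ++ x :: y :: b, w ∈ Set.Icc p01 p11) →
    k ≤ (a ++ x :: y :: b).length → y ≤ x →
      listValue p01 p11 β k r s (a ++ y :: x :: b) ≤ listValue p01 p11 β k r s (a ++ x :: y :: b)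

/-- Moving the last belief to the front loses at most `M`. -/
def RotateLossLE (p01 p11 β : ℝ) (k : ℕ) (r : ℕ → ℝ) (M : ℝ) (s : ℕ) : Prop :=
  ∀ (l : List ℝ) (z : ℝ), (∀ w ∈ z :: l, w ∈ Set.Icc p01 p11) → k ≤ (z :: l).length →
    listValue p01 p11 β k r s (l ++ [z]) ≤ M + listValue p01 p11 β k r s (z :: l)

theorem SwapMono.move_small {s : ℕ} (h : SwapMono p01 p11 β k r s) (a l b : List ℝ) (z : ℝ)
    (hz : ∀ w ∈ l, z ≤ w) (hmem : ∀ w ∈ a ++ z :: (l ++ b), w ∈ Set.Icc p01 p11)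
    (hk : k ≤ (a ++ z :: (l ++ b)).length) :
    listValue p01 p11 β k r s (a ++ z :: (l ++ b)) ≤
      listValue p01 p11 β k r s (a ++ (l ++ z :: b)) := by
  induction l generalizing a with
  | nil => simp
  | cons x l ih =>
    refine (h a (l ++ b) x z (fun w hw => hmem w ?_) (by simp at hk ⊢; omega)
      (hz x (by simp))).trans ?_
    · simp at hw ⊢; tauto
    · have := ih (a ++ [x]) (fun w hw => hz w (by simp [hw]))
        (fun w hw => hmem w (by simp at hw ⊢; tauto)) (by simp at hk ⊢; omega)
      simpa using this

theorem SwapMono.move_large {s : ℕ} (h : SwapMono p01 p11 β k r s) (a l b : List ℝ) (z : ℝ)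
    (hz : ∀ w ∈ l, w ≤ z) (hmem : ∀ w ∈ a ++ z :: (l ++ b), w ∈ Set.Icc p01 p11)
    (hk : k ≤ (a ++ z :: (l ++ b)).length) :
    listValue p01 p11 β k r s (a ++ (l ++ z :: b)) ≤
      listValue p01 p11 β k r s (a ++ z :: (l ++ b)) := by
  induction l generalizing a with
  | nil => simp
  | cons x l ih =>
    refine le_trans ?_ (h a (l ++ b) z x (fun w hw => hmem w ?_) (by simp at hk ⊢; omega)
      (hz x (by simp)))
    · have := ih (a ++ [x]) (fun w hw => hz w (by simp [hw]))
        (fun w hw => hmem w (by simp at hw ⊢; tauto)) (by simp at hk ⊢; omega)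
      simpa using this
    · simp at hw ⊢; tauto

theorem SwapMono.le_orderedInsert {s : ℕ} (h : SwapMono p01 p11 β k r s) (a t : List ℝ) (x : ℝ)
    (hmem : ∀ w ∈ a ++ x :: t, w ∈ Set.Icc p01 p11) (hk : k ≤ (a ++ x :: t).length) :
    listValue p01 p11 β k r s (a ++ x :: t) ≤
      listValue p01 p11 β k r s (a ++ t.orderedInsert (· ≥ ·) x) := by
  induction t generalizing a with
  | nil => simp
  | cons y t ih =>
    rw [List.orderedInsert_cons]
    split_ifs with hxy
    · exact le_rfl
    · refine (h a t y x (fun w hw => hmem w (by simp at hw ⊢; tauto)) (by simpa using hk)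
        (by linarith)).trans ?_
      have := ih (a ++ [y]) (fun w hw => hmem w (by simp at hw ⊢; tauto)) (by simpa using hk)
      simpa using this

theorem SwapMono.le_insertionSort {s : ℕ} (h : SwapMono p01 p11 β k r s) (a l : List ℝ)
    (hmem : ∀ w ∈ a ++ l, w ∈ Set.Icc p01 p11) (hk : k ≤ (a ++ l).length) :
    listValue p01 p11 β k r s (a ++ l) ≤
      listValue p01 p11 β k r s (a ++ l.insertionSort (· ≥ ·)) := by
  induction l generalizing a with
  | nil => simp
  | cons x l ih =>
    have h₁ := ih (a ++ [x]) (fun w hw => hmem w (by simpa using hw)) (by simpa using hk)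
    have h₂ := h.le_orderedInsert a (l.insertionSort (· ≥ ·)) x
      (fun w hw => hmem w (by simpa using hw)) (by simpa using hk)
    simp only [List.append_assoc, List.singleton_append] at h₁
    exact h₁.trans h₂

theorem SwapMono.le_of_perm {s : ℕ} (h : SwapMono p01 p11 β k r s) {l l' : List ℝ}
    (hl : l.Perm l') (hs : l'.Pairwise (· ≥ ·)) (hmem : ∀ w ∈ l, w ∈ Set.Icc p01 p11)
    (hk : k ≤ l.length) :
    listValue p01 p11 β k r s l ≤ listValue p01 p11 β k r s l' := by
  have e : l.insertionSort (· ≥ ·) = l' :=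
    ((List.perm_insertionSort _ l).trans hl).eq_of_pairwise'
      (List.pairwise_insertionSort _ l) hs
  have := h.le_insertionSort [] l (by simpa using hmem) (by simpa using hk)
  simpa [e] using this

theorem listValue_succ_perm {u u' : List ℝ} (hu : u.length = k) (h : u.Perm u') (t : List ℝ)
    (s : ℕ) : listValue p01 p11 β k r (s + 1) (u ++ t) =
      listValue p01 p11 β k r (s + 1) (u' ++ t) := by
  rw [listValue_succ_append hu, listValue_succ_append (h.length_eq ▸ hu), countExp_perm h]

theorem listValue_succ_append_cons {u : List ℝ} (hu : u.length + 1 = k) (x : ℝ) (t : List ℝ)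
    (s : ℕ) : listValue p01 p11 β k r (s + 1) (u ++ x :: t) = countExp u fun c =>
      x * (r (c + 1) + β * listValue p01 p11 β k r s (nextList p01 p11 k t (c + 1))) +
        (1 - x) * (r c + β * listValue p01 p11 β k r s (nextList p01 p11 k t c)) := by
  have h := listValue_succ_append (p01 := p01) (p11 := p11) (β := β) (r := r)
    (u := u ++ [x]) (by simpa using hu) t s
  rw [List.append_assoc, List.singleton_append] at h
  rw [h, countExp_append_cons, List.append_nil, ← countExp_const_mul, ← countExp_const_mul,
    ← countExp_add]

theorem listValue_nextList_append_cons (s : ℕ) (a b : List ℝ) (x : ℝ) (c : ℕ) :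
    listValue p01 p11 β k r s (nextList p01 p11 k (a ++ x :: b) c) =
      x * listValue p01 p11 β k r s (List.replicate c p11 ++ (a.map (tau p01 p11) ++
        p11 :: (b.map (tau p01 p11) ++ List.replicate (k - c) p01))) +
      (1 - x) * listValue p01 p11 β k r s (List.replicate c p11 ++ (a.map (tau p01 p11) ++
        p01 :: (b.map (tau p01 p11) ++ List.replicate (k - c) p01))) := by
  have h := listValue_affine (p01 := p01) (p11 := p11) (β := β) (k := k) (r := r) s
    (List.replicate c p11 ++ a.map (tau p01 p11))
    (b.map (tau p01 p11) ++ List.replicate (k - c) p01) x p11 p01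
  simpa [nextList, tau] using h

theorem RotateLossLE.move_low {M : ℝ} {s : ℕ} (hR : RotateLossLE p01 p11 β k r M s)
    (hS : SwapMono p01 p11 β k r s) (hp : p01 ≤ p11) (a t : List ℝ) (n : ℕ)
    (ha : ∀ w ∈ a, w ∈ Set.Icc p01 p11) (ht : ∀ w ∈ t, w ∈ Set.Icc p01 p11)
    (hk : k ≤ a.length + t.length + n + 1) :
    listValue p01 p11 β k r s (a ++ (t ++ p01 :: List.replicate n p01)) ≤
      M + listValue p01 p11 β k r s (a ++ p01 :: (t ++ List.replicate n p01)) := by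
  have hmem : ∀ w ∈ p01 :: (a ++ (t ++ List.replicate n p01)), w ∈ Set.Icc p01 p11 := by
    intro w hw
    simp only [List.mem_cons, List.mem_append, List.mem_replicate] at hw
    rcases hw with rfl | hw | hw | ⟨-, rfl⟩
    exacts [⟨le_rfl, hp⟩, ha w hw, ht w hw, ⟨le_rfl, hp⟩]
  have h₁ := hR (a ++ (t ++ List.replicate n p01)) p01 hmem (by simp; omega)
  have h₂ := hS.move_small [] a (t ++ List.replicate n p01) p01 (fun w hw => (ha w hw).1)
    hmem (by simp; omega)
  have e : a ++ (t ++ List.replicate n p01) ++ [p01] =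
      a ++ (t ++ p01 :: List.replicate n p01) := by
    simp [← List.replicate_succ', List.replicate_succ]
  rw [e] at h₁
  simp only [List.nil_append] at h₂
  linarith

theorem map_tau_mem_Icc (h0 : 0 ≤ p01) (h1 : p11 ≤ 1) (hp : p01 ≤ p11) {t : List ℝ}
    (ht : ∀ w ∈ t, w ∈ Set.Icc p01 p11) :
    ∀ w ∈ t.map (tau p01 p11), w ∈ Set.Icc p01 p11 := by
  intro w hw
  obtain ⟨v, hv, rfl⟩ := List.mem_map.1 hw
  exact tau_mem_Icc hp ⟨h0.trans (ht v hv).1, (ht v hv).2.trans h1⟩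

theorem replicate_mem_Icc {p : ℝ} (h : p ∈ Set.Icc p01 p11) (n : ℕ) :
    ∀ w ∈ List.replicate n p, w ∈ Set.Icc p01 p11 := by
  intro w hw
  rwa [(List.mem_replicate.1 hw).2]

theorem SwapMono.succ {M Rl : ℝ} {s : ℕ} (h0 : 0 ≤ p01) (h1 : p11 ≤ 1) (hp : p01 ≤ p11)
    (hβ0 : 0 ≤ β) (hM : β * M ≤ Rl)
    (hRl : ∀ u : List ℝ, u.length + 1 = k → (∀ w ∈ u, w ∈ Set.Icc p01 p11) →
      Rl ≤ countExp u fun c => r (c + 1) - r c)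
    (hS : SwapMono p01 p11 β k r s) (hR : RotateLossLE p01 p11 β k r M s) :
    SwapMono p01 p11 β k r (s + 1) := by
  intro a b x y hmem hk hxy
  have h01 : ∀ w ∈ a ++ x :: y :: b, w ∈ Set.Icc (0 : ℝ) 1 := fun w hw =>
    ⟨h0.trans (hmem w hw).1, (hmem w hw).2.trans h1⟩
  have hb' := map_tau_mem_Icc h0 h1 hp (t := b) fun w hw => hmem w (by simp [hw])
  rcases lt_trichotomy (a.length + 1) k with h | h | h
  · -- both entries are sensed
    obtain ⟨n, hn⟩ : ∃ n, k = a.length + 2 + n := ⟨k - a.length - 2, by omega⟩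
    have e : ∀ x y : ℝ, a ++ x :: y :: b = (a ++ x :: y :: b.take n) ++ b.drop n := by simp
    rw [e x y, e y x]
    refine (listValue_succ_perm ?_ ((List.Perm.swap x y _).append_left a) _ s).le
    simp at hk ⊢; omega
  · -- only the first of the two entries is sensed
    have hx := h01 x (by simp)
    have ha : ∀ w ∈ a, w ∈ Set.Icc p01 p11 := fun w hw => hmem w (by simp [hw])
    have hd := hRl a h ha
    rw [listValue_succ_append_cons h, listValue_succ_append_cons h]
    have key := countExp_mono (u := a) (fun w hw => h01 w (by simp [hw]))
      (f := fun c => (x - y) * (r (c + 1) - r c) + ((- ((x - y) * (β * M))) +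
        (y * (r (c + 1) + β * listValue p01 p11 β k r s (nextList p01 p11 k (x :: b) (c + 1))) +
        (1 - y) * (r c + β * listValue p01 p11 β k r s (nextList p01 p11 k (x :: b) c)))))
      (g := fun c =>
        x * (r (c + 1) + β * listValue p01 p11 β k r s (nextList p01 p11 k (y :: b) (c + 1))) +
        (1 - x) * (r c + β * listValue p01 p11 β k r s (nextList p01 p11 k (y :: b) c))) ?_
    · rw [countExp_add, countExp_add, countExp_const, countExp_const_mul] at key
      nlinarith
    · intro c hc
      have loss := hR.move_low hS hp (List.replicate (c + 1) p11) (b.map (tau p01 p11))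
        (k - (c + 1)) (replicate_mem_Icc ⟨hp, le_rfl⟩ _) hb' (by simp; omega)
      have hQ : List.replicate (k - c) p01 = p01 :: List.replicate (k - (c + 1)) p01 := by
        rw [← List.replicate_succ]; congr 1; omega
      have e := listValue_nextList_append_cons (p01 := p01) (p11 := p11) (β := β) (k := k)
        (r := r) s [] b
      have hP : ∀ l : List ℝ, List.replicate c p11 ++ p11 :: l =
          List.replicate (c + 1) p11 ++ l := by simp [List.replicate_succ']
      simp only [List.nil_append, List.map_nil] at e
      simp only [e, hQ, hP]
      have := mul_le_mul_of_nonneg_left loss (mul_nonneg hβ0 (sub_nonneg.2 hxy))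
      linarith
  · -- neither entry is sensed
    obtain ⟨u, v, rfl, hu⟩ : ∃ u v, a = u ++ v ∧ u.length = k :=
      ⟨a.take k, a.drop k, by simp, by simp; omega⟩
    rw [List.append_assoc, List.append_assoc, listValue_succ_append hu, listValue_succ_append hu]
    refine countExp_mono (fun w hw => h01 w (by simp [hw])) fun c hc => ?_
    have := hS (List.replicate c p11 ++ v.map (tau p01 p11))
      (b.map (tau p01 p11) ++ List.replicate (k - c) p01) (tau p01 p11 x) (tau p01 p11 y) ?_
      (by simp; omega) (tau_mono hp hxy)
    · have := mul_le_mul_of_nonneg_left this hβ0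
      simp only [List.append_assoc] at this
      simpa [nextList] using this
    · have hT := map_tau_mem_Icc h0 h1 hp (t := v ++ x :: y :: b)
        fun w hw => hmem w (by simp at hw ⊢; tauto)
      have hP := replicate_mem_Icc (p01 := p01) ⟨hp, le_refl p11⟩ c
      have hQ := replicate_mem_Icc (p11 := p11) ⟨le_refl p01, hp⟩ (k - c)
      intro w hw
      simp only [List.map_append, List.map_cons, List.mem_append, List.mem_cons] at hw hT
      rcases hw with (hw | hw) | hw | hw | hw | hw
      exacts [hP w hw, hT w (by tauto), hT w (by tauto), hT w (by tauto), hT w (by tauto), hQ w hw]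

theorem RotateLossLE.succ {M Rl : ℝ} {s : ℕ} (h0 : 0 ≤ p01) (h1 : p11 ≤ 1) (hp : p01 ≤ p11)
    (hk : 1 ≤ k) (hβ0 : 0 ≤ β) (hβ1 : β ≤ 1) (hM0 : 0 ≤ M) (hM : β * M ≤ Rl)
    (hRl : ∀ u : List ℝ, u.length + 1 = k → (∀ w ∈ u, w ∈ Set.Icc p01 p11) →
      Rl ≤ countExp u fun c => r (c + 1) - r c)
    (hRM : ∀ u : List ℝ, u.length + 1 = k → (∀ w ∈ u, w ∈ Set.Icc p01 p11) →
      (countExp u fun c => r (c + 1) - r c) ≤ M)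
    (hS : SwapMono p01 p11 β k r s) (hR : RotateLossLE p01 p11 β k r M s) :
    RotateLossLE p01 p11 β k r M (s + 1) := by
  intro l z hmem hkl
  rcases hkl.eq_or_lt with h | h
  · have := listValue_succ_perm (p01 := p01) (p11 := p11) (β := β) (r := r) h.symm
      (List.perm_append_singleton z l).symm [] s
    simp only [List.append_nil] at this
    linarith
  · have hlen : k - 1 < l.length := by simp at h; omega
    obtain ⟨u, w, v, rfl, hu⟩ : ∃ u w v, l = u ++ w :: v ∧ u.length + 1 = k :=
      ⟨l.take (k - 1), l[k - 1], l.drop k, by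
        rw [show l.drop k = l.drop (k - 1 + 1) by rw [Nat.sub_add_cancel hk]]
        simp, by simp; omega⟩
    have h01 : ∀ y ∈ z :: (u ++ w :: v), y ∈ Set.Icc (0 : ℝ) 1 := fun y hy =>
      ⟨h0.trans (hmem y hy).1, (hmem y hy).2.trans h1⟩
    obtain ⟨hw0, hw1⟩ := h01 w (by simp)
    obtain ⟨hz0, hz1⟩ := h01 z (by simp)
    have huI : ∀ y ∈ u, y ∈ Set.Icc p01 p11 := fun y hy => hmem y (by simp [hy])
    have hv' := map_tau_mem_Icc h0 h1 hp (t := v) fun y hy => hmem y (by simp [hy])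
    have hl := hRl u hu huI
    have hr := hRM u hu huI
    have e₁ : z :: (u ++ w :: v) = (z :: u) ++ w :: v := by simp
    have e₂ : u ++ [z] ++ w :: v = u ++ z :: w :: v := by simp
    rw [e₁, listValue_succ_perm (by simpa using hu) (List.perm_append_singleton z u).symm, e₂,
      List.append_assoc, List.cons_append, listValue_succ_append_cons hu,
      listValue_succ_append_cons hu]
    have key := countExp_mono (u := u) (fun y hy => h01 y (by simp [hy]))
      (f := fun c =>
        w * (r (c + 1) +
          β * listValue p01 p11 β k r s (nextList p01 p11 k (v ++ [z]) (c + 1))) +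
        (1 - w) * (r c + β * listValue p01 p11 β k r s (nextList p01 p11 k (v ++ [z]) c)))
      (g := fun c => (w * (1 - z) - (1 - w) * z) * (r (c + 1) - r c) +
        (((1 - w) * z * (β * M) + (1 - w) * (1 - z) * (β * M)) +
        (z * (r (c + 1) + β * listValue p01 p11 β k r s (nextList p01 p11 k (w :: v) (c + 1))) +
        (1 - z) * (r c + β * listValue p01 p11 β k r s (nextList p01 p11 k (w :: v) c))))) ?_
    · rw [countExp_add u (fun c => (w * (1 - z) - (1 - w) * z) * (r (c + 1) - r c)),
        countExp_add u (fun _ => (1 - w) * z * (β * M) + (1 - w) * (1 - z) * (β * M)),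
        countExp_const, countExp_const_mul] at key
      have hβM : β * M ≤ M := mul_le_of_le_one_left hM0 hβ1
      have i₁ := mul_le_mul_of_nonneg_left hr (mul_nonneg hw0 (sub_nonneg.2 hz1))
      have i₂ := mul_le_mul_of_nonneg_left (hM.trans hl) (mul_nonneg (sub_nonneg.2 hw1) hz0)
      have i₃ := mul_le_mul_of_nonneg_left hβM
        (mul_nonneg (sub_nonneg.2 hw1) (sub_nonneg.2 hz1))
      have i₄ : (w * (1 - z) + (1 - w) * (1 - z)) * M ≤ M := by
        have : (1 - z) * M ≤ 1 * M := mul_le_mul_of_nonneg_right (by linarith) hM0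
        linarith
      linarith
    · intro c hc
      set t := v.map (tau p01 p11) with ht
      have hPm : ∀ n, ∀ y ∈ List.replicate n p11, y ∈ Set.Icc p01 p11 :=
        replicate_mem_Icc ⟨hp, le_rfl⟩
      have hQm : ∀ n, ∀ y ∈ List.replicate n p01, y ∈ Set.Icc p01 p11 :=
        replicate_mem_Icc ⟨le_rfl, hp⟩
      have hbig : ∀ n j, ∀ y ∈ List.replicate n p11 ++ p11 :: (t ++ List.replicate j p01),
          y ∈ Set.Icc p01 p11 := by
        intro n j y hy
        simp only [List.mem_append, List.mem_cons] at hy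
        rcases hy with hy | rfl | hy | hy
        exacts [hPm n y hy, ⟨hp, le_rfl⟩, hv' y hy, hQm j y hy]
      have hQ : List.replicate (k - c) p01 = p01 :: List.replicate (k - (c + 1)) p01 := by
        rw [← List.replicate_succ]; congr 1; omega
      have hP : ∀ l : List ℝ, List.replicate c p11 ++ p11 :: l =
          List.replicate (c + 1) p11 ++ l := by simp [List.replicate_succ']
      have d₁₁ := hS.move_large (List.replicate (c + 1) p11) t
        (List.replicate (k - (c + 1)) p01) p11 (fun y hy => (hv' y hy).2)
        (hbig _ _) (by simp; omega)
      have d₀₁ := hS.move_large (List.replicate c p11) t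
        (List.replicate (k - c) p01) p11 (fun y hy => (hv' y hy).2)
        (hbig _ _) (by simp; omega)
      have d₁ := hR.move_low hS hp (List.replicate (c + 1) p11) t
        (k - (c + 1)) (hPm _) hv' (by simp; omega)
      have d₀₀ := hR.move_low hS hp (List.replicate c p11) t
        (k - c) (hPm _) hv' (by simp; omega)
      have E₁ := listValue_nextList_append_cons (p01 := p01) (p11 := p11) (β := β) (k := k)
        (r := r) s [] v w
      have E₂ := listValue_nextList_append_cons (p01 := p01) (p11 := p11) (β := β) (k := k)
        (r := r) s v [] z
      simp only [List.nil_append, List.map_nil] at E₁ E₂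
      rw [E₁, E₁, E₂, E₂, ← ht]
      rw [hQ, hP] at d₀₁
      simp only [hQ, hP] at d₀₀ ⊢
      have j₁₁ := mul_le_mul_of_nonneg_left d₁₁ (mul_nonneg hβ0 (mul_nonneg hw0 hz0))
      have j₀₁ := mul_le_mul_of_nonneg_left (d₀₁.trans d₁)
        (mul_nonneg hβ0 (mul_nonneg (sub_nonneg.2 hw1) hz0))
      have j₀₀ := mul_le_mul_of_nonneg_left d₀₀
        (mul_nonneg hβ0 (mul_nonneg (sub_nonneg.2 hw1) (sub_nonneg.2 hz1)))
      linarith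

theorem swapMono_and_rotateLossLE {M Rl : ℝ} (h0 : 0 ≤ p01) (h1 : p11 ≤ 1) (hp : p01 ≤ p11)
    (hk : 1 ≤ k) (hβ0 : 0 ≤ β) (hβ1 : β ≤ 1) (hM0 : 0 ≤ M) (hM : β * M ≤ Rl)
    (hRl : ∀ u : List ℝ, u.length + 1 = k → (∀ w ∈ u, w ∈ Set.Icc p01 p11) →
      Rl ≤ countExp u fun c => r (c + 1) - r c)
    (hRM : ∀ u : List ℝ, u.length + 1 = k → (∀ w ∈ u, w ∈ Set.Icc p01 p11) →
      (countExp u fun c => r (c + 1) - r c) ≤ M) (s : ℕ) :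
    SwapMono p01 p11 β k r s ∧ RotateLossLE p01 p11 β k r M s := by
  induction s with
  | zero =>
    exact ⟨fun a b x y _ _ _ => le_rfl, fun l z _ _ => by simpa [listValue] using hM0⟩
  | succ s ih =>
    exact ⟨ih.1.succ h0 h1 hp hβ0 hM hRl ih.2,
      ih.2.succ h0 h1 hp hk hβ0 hβ1 hM0 hM hRl hRM ih.1⟩

end ListValue

theorem expReward_eq_countExp {ι : Type*} [DecidableEq ι] (m : ℕ) (S : Finset ι) (ω : ι → ℝ) :
    expReward m S ω = countExp (S.toList.map ω) fun a => ((min a m : ℕ) : ℝ) :=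
  sum_powerset_eq_countExp S ω fun a => ((min a m : ℕ) : ℝ)

theorem expReward_univ_cons (m n : ℕ) (b : ℝ) (x : Fin n → ℝ) :
    expReward m Finset.univ (Fin.cons b x : Fin (n + 1) → ℝ) =
      countExp (b :: List.ofFn x) fun a => ((min a m : ℕ) : ℝ) := by
  have h := sum_powerset_toFinset_eq_countExp (List.nodup_finRange (n + 1))
    (Fin.cons b x : Fin (n + 1) → ℝ) fun a => ((min a m : ℕ) : ℝ)
  rw [List.toFinset_finRange, ← List.ofFn_eq_map, List.ofFn_succ] at h
  simpa [expReward] using h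

theorem expReward_cons_one_sub_cons_zero (m n : ℕ) (x : Fin n → ℝ) :
    expReward m Finset.univ (Fin.cons 1 x : Fin (n + 1) → ℝ) -
        expReward m Finset.univ (Fin.cons 0 x : Fin (n + 1) → ℝ) =
      countExp (List.ofFn x) fun a => ((min (a + 1) m : ℕ) : ℝ) - ((min a m : ℕ) : ℝ) := by
  rw [expReward_univ_cons, expReward_univ_cons, countExp_sub]
  simp [countExp]

theorem countExp_increment_mem_Icc {m : ℕ} {u : List ℝ} (hu : ∀ x ∈ u, x ∈ Set.Icc (0 : ℝ) 1) :
    (countExp u fun a => ((min (a + 1) m : ℕ) : ℝ) - ((min a m : ℕ) : ℝ)) ∈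
      Set.Icc (0 : ℝ) 1 := by
  constructor
  · refine (countExp_const u 0).symm.le.trans (countExp_mono hu fun a _ => sub_nonneg.2 ?_)
    exact_mod_cast min_le_min_right m a.le_succ
  · refine (countExp_mono hu fun a _ => ?_).trans (countExp_const u 1).le
    rw [sub_le_iff_le_add]
    exact_mod_cast (by omega : min (a + 1) m ≤ 1 + min a m)

theorem countExp_increment_mem_RdiffSet {lo hi : ℝ} (m : ℕ) {u : List ℝ}
    (hu : ∀ x ∈ u, x ∈ Set.Icc lo hi) :
    (countExp u fun a => ((min (a + 1) m : ℕ) : ℝ) - ((min a m : ℕ) : ℝ)) ∈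
      RdiffSet lo hi m u.length :=
  ⟨u.get, fun i => hu _ (u.get_mem i), by
    rw [expReward_cons_one_sub_cons_zero, List.ofFn_get]⟩

theorem RdiffSet_subset_Icc {lo hi : ℝ} (h0 : 0 ≤ lo) (h1 : hi ≤ 1) (m n : ℕ) :
    RdiffSet lo hi m n ⊆ Set.Icc 0 1 := by
  rintro _ ⟨x, hx, rfl⟩
  rw [expReward_cons_one_sub_cons_zero]
  refine countExp_increment_mem_Icc fun y hy => ?_
  obtain ⟨i, rfl⟩ := (List.mem_ofFn' _ _).1 hy
  exact ⟨h0.trans (hx i).1, (hx i).2.trans h1⟩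

theorem ofFn_nextPos (p01 p11 : ℝ) {N k : ℕ} (hkN : k ≤ N) (ω : Fin N → ℝ) {c : ℕ}
    (hc : c ≤ k) :
    List.ofFn (nextPos p01 p11 k ω c) = nextList p01 p11 k ((List.ofFn ω).drop k) c := by
  refine List.ext_getElem (by simp [nextList]; omega) fun i h₁ h₂ => ?_
  simp only [nextList, nextPos, List.getElem_ofFn, List.getElem_append, List.length_replicate,
    List.getElem_replicate, List.getElem_map, List.getElem_drop, List.length_map,
    List.length_drop, List.length_ofFn]
  split_ifs <;> first | rfl | omega

theorem toFinset_take_finRange (N k : ℕ) :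
    ((List.finRange N).take k).toFinset = senseSet N k := by
  ext i
  simp only [List.mem_toFinset, senseSet, Finset.mem_filter, Finset.mem_univ, true_and,
    List.mem_take_iff_getElem, List.getElem_finRange]
  constructor
  · rintro ⟨j, hj, rfl⟩
    simp at hj ⊢
    omega
  · intro h
    exact ⟨i, by simp; omega, by simp⟩

theorem sum_powerset_senseSet {N : ℕ} (k : ℕ) (ω : Fin N → ℝ) (f : ℕ → ℝ) :
    ∑ A ∈ (senseSet N k).powerset,
        (∏ i ∈ A, ω i) * (∏ i ∈ senseSet N k \ A, (1 - ω i)) * f A.card =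
      countExp ((List.ofFn ω).take k) f := by
  have h := sum_powerset_toFinset_eq_countExp (L := (List.finRange N).take k)
    ((List.nodup_finRange N).sublist (List.take_sublist _ _)) ω f
  rwa [toFinset_take_finRange, List.map_take, ← List.ofFn_eq_map] at h

theorem Wpos_eq_listValue (p01 p11 β : ℝ) {N k : ℕ} (m : ℕ) (hkN : k ≤ N) (s : ℕ)
    (ω : Fin N → ℝ) :
    Wpos p01 p11 β N k m s ω =
      listValue p01 p11 β k (fun a => ((min a m : ℕ) : ℝ)) (s + 1) (List.ofFn ω) := by
  have hR : ∀ ω : Fin N → ℝ, expReward m (senseSet N k) ω =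
      countExp ((List.ofFn ω).take k) fun a => ((min a m : ℕ) : ℝ) := fun ω =>
    sum_powerset_senseSet k ω fun a => ((min a m : ℕ) : ℝ)
  induction s generalizing ω with
  | zero => simp [Wpos, listValue, hR]
  | succ s ih =>
    rw [Wpos, hR, listValue, countExp_add, countExp_const_mul]
    simp only [ih]
    rw [sum_powerset_senseSet k ω fun c => listValue p01 p11 β k
      (fun a => ((min a m : ℕ) : ℝ)) (s + 1) (List.ofFn (nextPos p01 p11 k ω c))]
    congr 2
    refine countExp_congr fun c hc => ?_
    rw [ofFn_nextPos p01 p11 hkN ω (hc.trans (by simp))]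

/-- Sensing `π` and then following a policy whose value on sorted belief vectors is the myopic one
is worth the list value of the beliefs in `π` followed by the remaining ones in sorted order. -/
theorem expReward_add_eq_listValue {p01 p11 β : ℝ} {N k m s : ℕ} (h0 : 0 ≤ p01) (h1 : p11 ≤ 1)
    (hp : p01 ≤ p11) {V : (Fin N → ℝ) → ℝ}
    (hV : ∀ ω : Fin N → ℝ, (∀ i, ω i ∈ Set.Icc p01 p11) → ∀ L : List (Fin N),
      L.Perm (List.finRange N) → (L.map ω).Pairwise (· ≥ ·) →
        V ω = listValue p01 p11 β k (fun a => ((min a m : ℕ) : ℝ)) s (L.map ω))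
    {ω : Fin N → ℝ} (hω : ∀ i, ω i ∈ Set.Icc p01 p11) {L : List (Fin N)}
    (hL : L.Perm (List.finRange N)) (hs : (L.map ω).Pairwise (· ≥ ·))
    {π : Finset (Fin N)} (hπ : π.card = k) :
    expReward m π ω + β * ∑ B ∈ π.powerset, (∏ i ∈ B, ω i) * (∏ i ∈ π \ B, (1 - ω i)) *
        V (fun j => if j ∈ B then p11 else if j ∈ π then p01 else tau p01 p11 (ω j)) =
      listValue p01 p11 β k (fun a => ((min a m : ℕ) : ℝ)) (s + 1)
        (π.toList.map ω ++ (L.filter (· ∉ π)).map ω) := by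
  have hω01 : ∀ i, ω i ∈ Set.Icc (0 : ℝ) 1 := fun i =>
    ⟨h0.trans (hω i).1, (hω i).2.trans h1⟩
  have hLn : L.Nodup := hL.nodup_iff.2 (List.nodup_finRange N)
  have hLm : ∀ i, i ∈ L := fun i => hL.mem_iff.2 (List.mem_finRange i)
  rw [listValue_succ_append (by simpa using hπ), countExp_add, countExp_const_mul,
    ← expReward_eq_countExp, ← sum_powerset_eq_countExp]
  congr 2
  refine Finset.sum_congr rfl fun B hB => ?_
  rw [Finset.mem_powerset] at hB
  congr 1
  set ω' : Fin N → ℝ :=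
    fun j => if j ∈ B then p11 else if j ∈ π then p01 else tau p01 p11 (ω j) with hω'
  have hmap : (B.toList ++ (L.filter (· ∉ π) ++ (π \ B).toList)).map ω' =
      nextList p01 p11 k ((L.filter (· ∉ π)).map ω) B.card := by
    rw [nextList, List.map_append, List.map_append, List.map_map]
    congr 1
    · refine List.eq_replicate_iff.2 ⟨by simp, ?_⟩
      simp +contextual [hω']
    congr 1
    · refine List.map_congr_left fun j hj => ?_
      have hjπ : j ∉ π := by simpa using (List.mem_filter.1 hj).2
      have hjB : j ∉ B := fun h => hjπ (hB h)
      simp [hω', hjπ, hjB]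
    · refine List.eq_replicate_iff.2
        ⟨by simp [Finset.card_sdiff_of_subset hB, hπ], ?_⟩
      simp +contextual [hω']
  rw [← hmap]
  refine hV ω' (fun i => ?_) _ ?_ ?_
  · simp only [hω']
    split_ifs
    exacts [⟨hp, le_rfl⟩, ⟨le_rfl, hp⟩, tau_mem_Icc hp (hω01 i)]
  · refine (List.perm_ext_iff_of_nodup ?_ (List.nodup_finRange N)).2 fun i => ?_
    · simp only [List.nodup_append', Finset.nodup_toList, hLn.filter, true_and,
        List.disjoint_left, List.mem_append, List.mem_filter, Finset.mem_toList,
        Finset.mem_sdiff, decide_eq_true_eq]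
      exact ⟨fun i hi h => hi.2 h.1, fun i hi h => h.elim (fun h => h.2 (hB hi)) fun h => h.2 hi⟩
    · simp only [List.mem_append, List.mem_filter, Finset.mem_toList, Finset.mem_sdiff, hLm,
        List.mem_finRange, decide_eq_true_eq]
      tauto
  · have hT : ∀ x ∈ ((L.filter (· ∉ π)).map ω).map (tau p01 p11), x ∈ Set.Icc p01 p11 := by
      refine map_tau_mem_Icc h0 h1 hp fun x hx => ?_
      obtain ⟨i, -, rfl⟩ := List.mem_map.1 hx
      exact hω i
    rw [hmap, nextList, List.pairwise_append, List.pairwise_append]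
    refine ⟨by simp [List.pairwise_replicate], ⟨?_, by simp [List.pairwise_replicate], ?_⟩, ?_⟩
    · refine List.Pairwise.map _ (fun x y hxy => tau_mono hp hxy) ?_
      exact hs.sublist (List.filter_sublist.map ω)
    · intro x hx y hy
      rw [(List.mem_replicate.1 hy).2]
      exact (hT x hx).1
    · intro x hx y hy
      rw [(List.mem_replicate.1 hx).2]
      rcases List.mem_append.1 hy with hy | hy
      · exact (hT y hy).2
      · rw [(List.mem_replicate.1 hy).2]
        exact hp

theorem sSup_eq_listValue {p01 p11 β : ℝ} {N k m s : ℕ} (h0 : 0 ≤ p01) (h1 : p11 ≤ 1)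
    (hp : p01 ≤ p11) (hkN : k ≤ N)
    (hS : SwapMono p01 p11 β k (fun a => ((min a m : ℕ) : ℝ)) (s + 1)) {V : (Fin N → ℝ) → ℝ}
    (hV : ∀ ω : Fin N → ℝ, (∀ i, ω i ∈ Set.Icc p01 p11) → ∀ L : List (Fin N),
      L.Perm (List.finRange N) → (L.map ω).Pairwise (· ≥ ·) →
        V ω = listValue p01 p11 β k (fun a => ((min a m : ℕ) : ℝ)) s (L.map ω))
    {ω : Fin N → ℝ} (hω : ∀ i, ω i ∈ Set.Icc p01 p11) {L : List (Fin N)}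
    (hL : L.Perm (List.finRange N)) (hs : (L.map ω).Pairwise (· ≥ ·)) :
    sSup { x : ℝ | ∃ π : Finset (Fin N), π.card = k ∧
      x = expReward m π ω + β * ∑ B ∈ π.powerset, (∏ i ∈ B, ω i) * (∏ i ∈ π \ B, (1 - ω i)) *
        V (fun j => if j ∈ B then p11 else if j ∈ π then p01 else tau p01 p11 (ω j)) } =
      listValue p01 p11 β k (fun a => ((min a m : ℕ) : ℝ)) (s + 1) (L.map ω) := by
  have hLn : L.Nodup := hL.nodup_iff.2 (List.nodup_finRange N)
  have hLm : ∀ i, i ∈ L := fun i => hL.mem_iff.2 (List.mem_finRange i)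
  have hLlen : L.length = N := by simpa using hL.length_eq
  refine IsGreatest.csSup_eq ⟨?_, ?_⟩
  · have htn : (L.take k).Nodup := hLn.sublist (List.take_sublist _ _)
    have hcard : (L.take k).toFinset.card = k := by
      rw [List.toFinset_card_of_nodup htn, List.length_take, hLlen, min_eq_left hkN]
    refine ⟨(L.take k).toFinset, hcard, ?_⟩
    rw [expReward_add_eq_listValue h0 h1 hp hV hω hL hs hcard,
      listValue_succ_perm (by simpa using hcard) ((List.toFinset_toList htn).map ω),
      ← List.map_append]
    congr 2
    nth_rw 1 [← List.take_append_drop k L]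
    congr 1
    have hd : (L.take k).Disjoint (L.drop k) :=
      List.disjoint_of_nodup_append (by rwa [List.take_append_drop])
    conv_rhs => rw [← List.take_append_drop k L]
    rw [List.filter_append, List.filter_eq_nil_iff.2, List.filter_eq_self.2, List.nil_append]
    · intro i hi
      simpa using fun h => hd h hi
    · intro i hi
      simpa using hi
  · rintro x ⟨π, hπ, rfl⟩
    rw [expReward_add_eq_listValue h0 h1 hp hV hω hL hs hπ]
    refine hS.le_of_perm ?_ hs ?_ ?_
    · rw [← List.map_append]
      refine List.Perm.map ω ((List.perm_ext_iff_of_nodup ?_ hLn).2 fun i => ?_)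
      · simp only [List.nodup_append', Finset.nodup_toList, hLn.filter, true_and,
          List.disjoint_left, List.mem_filter, Finset.mem_toList, decide_eq_true_eq]
        exact fun i hi h => h.2 hi
      · simp only [List.mem_append, List.mem_filter, Finset.mem_toList, hLm, decide_eq_true_eq]
        tauto
    · intro x hx
      rw [← List.map_append] at hx
      obtain ⟨i, -, rfl⟩ := List.mem_map.1 hx
      exact hω i
    · simp [hπ]

theorem Vopt_eq_listValue {p01 p11 β : ℝ} {N k m : ℕ} (h0 : 0 ≤ p01) (h1 : p11 ≤ 1)
    (hp : p01 ≤ p11) (hkN : k ≤ N)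
    (hS : ∀ s, SwapMono p01 p11 β k (fun a => ((min a m : ℕ) : ℝ)) s) (s : ℕ)
    {ω : Fin N → ℝ} (hω : ∀ i, ω i ∈ Set.Icc p01 p11) {L : List (Fin N)}
    (hL : L.Perm (List.finRange N)) (hs : (L.map ω).Pairwise (· ≥ ·)) :
    Vopt p01 p11 β N k m s ω =
      listValue p01 p11 β k (fun a => ((min a m : ℕ) : ℝ)) (s + 1) (L.map ω) := by
  induction s generalizing ω L with
  | zero =>
    rw [← sSup_eq_listValue h0 h1 hp hkN (hS 1) (V := fun _ => 0)
      (fun _ _ _ _ _ => by rw [listValue]) hω hL hs]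
    simp [Vopt]
  | succ s ih =>
    exact sSup_eq_listValue h0 h1 hp hkN (hS (s + 2)) (fun _ hω _ hL hs => ih hω hL hs) hω hL hs


/-- optimality of myopic sensing for the finite-horizon discounted
problem with positively correlated channels, under `β·ℛ̄ ≤ ℛ̲`. -/
theorem myopic_optimal_positive (p01 p11 β : ℝ) (h0 : p01 ∈ Set.Icc (0 : ℝ) 1)
    (h1 : p11 ∈ Set.Icc (0 : ℝ) 1) (hp : p01 ≤ p11)
    (N k m T : ℕ) (hm : 1 ≤ m) (hmk : m ≤ k) (hkN : k ≤ N) (hT : 1 ≤ T)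
    (hβ0 : 0 ≤ β) (hβ1 : β ≤ 1)
    (hcond : β * Rbar p01 p11 m (k - 1) ≤ Rlow p01 p11 m (k - 1)) :
    ∀ t, 1 ≤ t → t ≤ T → ∀ ω : Fin N → ℝ,
      (∀ i, ω i ∈ Set.Icc p01 p11) → Antitone ω →
      Wpos p01 p11 β N k m (T - t) ω = Vopt p01 p11 β N k m (T - t) ω := by
  have hk : 1 ≤ k := hm.trans hmk
  have hsub := RdiffSet_subset_Icc h0.1 h1.2 m (k - 1)
  have hmem : ∀ u : List ℝ, u.length + 1 = k → (∀ w ∈ u, w ∈ Set.Icc p01 p11) →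
      (countExp u fun a => ((min (a + 1) m : ℕ) : ℝ) - ((min a m : ℕ) : ℝ)) ∈
        RdiffSet p01 p11 m (k - 1) := by
    rintro u rfl hw
    exact countExp_increment_mem_RdiffSet m hw
  have hS : ∀ s, SwapMono p01 p11 β k (fun a => ((min a m : ℕ) : ℝ)) s := fun s =>
    (swapMono_and_rotateLossLE h0.1 h1.2 hp hk hβ0 hβ1 (Real.sSup_nonneg fun x hx => (hsub hx).1)
      hcond (fun u hu hw => csInf_le (bddBelow_Icc.mono hsub) (hmem u hu hw))
      (fun u hu hw => le_csSup (bddAbove_Icc.mono hsub) (hmem u hu hw)) s).1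
  intro t _ _ ω hω hanti
  rw [Wpos_eq_listValue p01 p11 β m hkN, List.ofFn_eq_map]
  refine (Vopt_eq_listValue h0.1 h1.2 hp hkN hS (T - t) hω (List.Perm.refl _) ?_).symm
  rw [← List.ofFn_eq_map, List.pairwise_ofFn]
  exact fun i j hij => hanti hij.le
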